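/- For 1 ≤ k ≤ n, the quotient ring S_{n,k} = ℚ[x_1,…,x_n]/J_{n,k} is a finite-dimensional ℚ-vector space of dimension equal to |W_{n,k}|, the number of packed words of length n in which every letter 1,2,…,k appears. -/

import Mathlib

open scoped BigOperators

namespace PackedWords

/-- An ordered set partition of `[n] = {1, …, n}` with `k` blocks: a sequence
`B_1 | ⋯ | B_k` of nonempty pairwise disjoint subsets of `[n]` whose union is `[n]`. -/
structure OSP (n k : ℕ) where
  blocks : Fin k → Finset ℕ
  subset_range : ∀ j, blocks j ⊆ Finset.Icc 1 n
  blocks_nonempty : ∀ j, (blocks j).Nonempty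
  blocks_disjoint : ∀ j₁ j₂ : Fin k, j₁ ≠ j₂ → Disjoint (blocks j₁) (blocks j₂)
  cover : ∀ i ∈ Finset.Icc 1 n, ∃ j, i ∈ blocks j

/-- Common generalization of the coinversion code (`b = 0`) and the boosted
coinversion code (`b = 1`).  Position `p : Fin n` corresponds to the letter
`i = p + 1` of `[n]`.  If `i ∈ B_j` (blocks indexed `0, …, k-1`, so `j` here is
the paper's `j - 1`), then `c_i = #{ℓ > j : min B_ℓ > i}` if `i = min B_j`, and
`c_i = #{ℓ > j : min B_ℓ > i} + (j - 1) + b` (in the paper's 1-indexing) otherwise. -/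
noncomputable def codeAux {n k : ℕ} (b : ℕ) (σ : OSP n k) (p : Fin n) : ℕ :=
  if h : ∃ j, ((p : ℕ) + 1) ∈ σ.blocks j then
    (Finset.univ.filter fun ℓ : Fin k =>
        h.choose < ℓ ∧ ∀ x ∈ σ.blocks ℓ, (p : ℕ) + 1 < x).card
      + (if ∀ x ∈ σ.blocks h.choose, (p : ℕ) + 1 ≤ x then 0 else (h.choose : ℕ) + b)
  else 0

/-- The coinversion code of an ordered set partition. -/
noncomputable def code {n k : ℕ} (σ : OSP n k) : Fin n → ℕ := codeAux 0 σ

/-- The boosted coinversion code of an ordered set partition. -/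
noncomputable def bcode {n k : ℕ} (σ : OSP n k) : Fin n → ℕ := codeAux 1 σ

/-- The skip sequence of a finite set `S = {s_1 < s_2 < ⋯} ⊆ ℕ`:
`γ_i = i - j + 1` if `i = s_j ∈ S`, and `γ_i = 0` otherwise. -/
def skip (S : Finset ℕ) (i : ℕ) : ℕ :=
  if i ∈ S then i - (S.filter (· < i)).card else 0

/-- The reverse skip sequence `γ(S)* = (γ_n, …, γ_1)` of `S ⊆ [n]`, read at
position `p : Fin n` (so position `p` carries `γ_{n - p}` in 1-indexed terms). -/
def revSkipAt (n : ℕ) (S : Finset ℕ) (p : Fin n) : ℕ := skip S (n - (p : ℕ))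

/-- For `T ⊆ [n-1]` with skip sequence `γ = γ(T)`, the length-`n` sequence
`(γ_{n-1}, …, γ_i, d, γ_{i-1}, …, γ_1)` obtained from the reverse skip sequence of `T`
by inserting `d` in position `n - i + 1` (1-indexed), read at position `p : Fin n`. -/
def insSeq (n i d : ℕ) (T : Finset ℕ) (p : Fin n) : ℕ :=
  if (p : ℕ) + 1 ≤ n - i then skip T (n - ((p : ℕ) + 1))
  else if (p : ℕ) + 1 = n - i + 1 then d
  else skip T (n - ((p : ℕ) + 1) + 1)

/-- `Packedk n k w`: `w` is a packed word of length `n` on the alphabet of positive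
integers (whenever `i + 1` appears as a letter, so does `i`) in which each of the
letters `1, 2, …, k` appears. -/
def Packedk (n k : ℕ) (w : Fin n → ℕ) : Prop :=
  (∀ p, 1 ≤ w p) ∧ (∀ i, 1 ≤ i → (∃ p, w p = i + 1) → ∃ p, w p = i) ∧
    (∀ j, 1 ≤ j → j ≤ k → ∃ p, w p = j)

/-- The elementary symmetric polynomial of degree `a` in the variables `X j`, `j ∈ s`. -/
noncomputable def esymmOn (n : ℕ) (s : Finset (Fin n)) (a : ℕ) : MvPolynomial (Fin n) ℚ :=
  ∑ t ∈ s.powersetCard a, ∏ j ∈ t, MvPolynomial.X j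

/-- The complete homogeneous symmetric polynomial of degree `b` evaluated at
`α 1, α 2, …, α d`. -/
noncomputable def hval (b d : ℕ) (α : ℕ → ℚ) : ℚ :=
  ∑ m : Sym (Fin d) b, ((m : Multiset (Fin d)).map fun j => α ((j : ℕ) + 1)).prod

/-- The locus `X_{n,k} ⊆ ℚ^n` of points `(α_{w_1}, …, α_{w_n})` for `w ∈ W_{n,k}`. -/
def packedPoints (n k : ℕ) (α : ℕ → ℚ) : Set (Fin n → ℚ) :=
  {x | ∃ w : Fin n → ℕ, Packedk n k w ∧ x = fun p => α (w p)}

/-- The ideal `J_n = ⟨x_i^d e_{n-r}^{(i)} : 1 ≤ i ≤ n, 1 ≤ r ≤ d⟩`. -/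
noncomputable def Jn (n : ℕ) : Ideal (MvPolynomial (Fin n) ℚ) :=
  Ideal.span {g | ∃ (i : Fin n) (r d : ℕ), 1 ≤ r ∧ r ≤ d ∧
    g = MvPolynomial.X i ^ d * esymmOn n {i}ᶜ (n - r)}

/-- The ideal `J_{n,k} = J_n + ⟨e_n, e_{n-1}, …, e_{n-k+1}⟩`. -/
noncomputable def Jnk (n k : ℕ) : Ideal (MvPolynomial (Fin n) ℚ) :=
  Jn n ⊔ Ideal.span {g | ∃ j : ℕ, n - k + 1 ≤ j ∧ j ≤ n ∧ g = esymmOn n Finset.univ j}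

/-- The Haglund–Rhoades–Shimozono ideal
`I_{n,k} = ⟨x_1^k, …, x_n^k, e_n, e_{n-1}, …, e_{n-k+1}⟩`. -/
noncomputable def Ink (n k : ℕ) : Ideal (MvPolynomial (Fin n) ℚ) :=
  Ideal.span ({g | ∃ i : Fin n, g = MvPolynomial.X i ^ k} ∪
    {g | ∃ j : ℕ, n - k + 1 ≤ j ∧ j ≤ n ∧ g = esymmOn n Finset.univ j})

/-- `T(X)`: the ideal generated by the top-degree homogeneous components `τ(f)` of
all nonzero polynomials `f` vanishing on `X`. -/
noncomputable def gradedIdeal (n : ℕ) (X : Set (Fin n → ℚ)) : Ideal (MvPolynomial (Fin n) ℚ) :=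
  Ideal.span {g | ∃ f : MvPolynomial (Fin n) ℚ, f ≠ 0 ∧
    (∀ x ∈ X, MvPolynomial.eval x f = 0) ∧
    g = MvPolynomial.homogeneousComponent f.totalDegree f}

/-- The degree-`d` homogeneous component of the quotient `ℚ[x_1, …, x_n]/I`,
namely the image of the space of homogeneous polynomials of degree `d`. -/
noncomputable def quotComp (n : ℕ) (I : Ideal (MvPolynomial (Fin n) ℚ)) (d : ℕ) :
    Submodule ℚ (MvPolynomial (Fin n) ℚ ⧸ I) :=
  Submodule.map (Ideal.Quotient.mkₐ ℚ I).toLinearMap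
    (MvPolynomial.homogeneousSubmodule (Fin n) ℚ d)

/-- The degree-`(d - a)` homogeneous component of `ℚ[x_1, …, x_n]/I`, interpreted as
zero when `d - a < 0` (degree shift by `a`). -/
noncomputable def quotCompShift (n : ℕ) (I : Ideal (MvPolynomial (Fin n) ℚ)) (d a : ℕ) :
    Submodule ℚ (MvPolynomial (Fin n) ℚ ⧸ I) :=
  if a ≤ d then quotComp n I (d - a) else ⊥

lemma packedk_comp {n k : ℕ} {w : Fin n → ℕ} (σ : Equiv.Perm (Fin n)) (h : Packedk n k w) :
    Packedk n k (w ∘ σ) := by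
  obtain ⟨h1, h2, h3⟩ := h
  refine ⟨fun p => h1 _, fun i hi hex => ?_, fun j hj hjk => ?_⟩
  · obtain ⟨q, hq⟩ := h2 i hi (by obtain ⟨p, hp⟩ := hex; exact ⟨σ p, hp⟩)
    exact ⟨σ.symm q, by simpa using hq⟩
  · obtain ⟨q, hq⟩ := h3 j hj hjk
    exact ⟨σ.symm q, by simpa using hq⟩

/-- The left action of a permutation `σ ∈ S_n` on packed words, sending `w` to
`w ∘ σ⁻¹` (the permutation action on positions). -/
noncomputable def wordPerm (n k : ℕ) (σ : Equiv.Perm (Fin n)) :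
    {w : Fin n → ℕ // Packedk n k w} ≃ {w : Fin n → ℕ // Packedk n k w} where
  toFun w := ⟨w.1 ∘ σ.symm, packedk_comp σ.symm w.2⟩
  invFun w := ⟨w.1 ∘ σ, packedk_comp σ w.2⟩
  left_inv w := Subtype.ext (funext fun p => by simp)
  right_inv w := Subtype.ext (funext fun p => by simp)

lemma rank_quotient_le_add_of_mul_mem {R : Type} [CommRing R] [Algebra ℚ R] {I I' : Ideal R}
    (f : R) (h : ∀ g ∈ I', f * g ∈ I) :
    Module.rank ℚ (R ⧸ I) ≤
      Module.rank ℚ (R ⧸ (I ⊔ Ideal.span {f})) + Module.rank ℚ (R ⧸ I') := by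
  let φ : (R ⧸ I) →ₗ[ℚ] (R ⧸ (I ⊔ Ideal.span {f})) :=
    (Ideal.Quotient.factorₐ ℚ (le_sup_left : I ≤ I ⊔ Ideal.span {f})).toLinearMap
  let ψ : (R ⧸ I') →ₗ[ℚ] (R ⧸ I) :=
    (Submodule.mapQ I' I (LinearMap.mulLeft R f) h).restrictScalars ℚ
  have hker : LinearMap.ker φ ≤ LinearMap.range ψ := by
    intro y hy
    obtain ⟨a, rfl⟩ := Ideal.Quotient.mk_surjective y
    have ha : a ∈ I ⊔ Ideal.span {f} := Ideal.Quotient.eq_zero_iff_mem.1 hy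
    obtain ⟨i, hi, z, hz, rfl⟩ := Submodule.mem_sup.1 ha
    obtain ⟨b, rfl⟩ := Ideal.mem_span_singleton'.1 hz
    refine ⟨Ideal.Quotient.mk I' b, ?_⟩
    change Ideal.Quotient.mk I (f * b) = _
    rw [Ideal.Quotient.eq]
    have : f * b - (i + b * f) = -i := by ring
    rw [this]
    exact I.neg_mem hi
  rw [← LinearMap.rank_range_add_rank_ker φ]
  exact add_le_add (Submodule.rank_le _)
    ((Submodule.rank_mono hker).trans (rank_range_le ψ))

lemma rank_quotient_mono {R : Type} [CommRing R] [Algebra ℚ R] {I J : Ideal R} (h : I ≤ J) :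
    Module.rank ℚ (R ⧸ J) ≤ Module.rank ℚ (R ⧸ I) :=
  LinearMap.rank_le_of_surjective (Ideal.Quotient.factorₐ ℚ h).toLinearMap
    (Ideal.Quotient.factor_surjective h)

lemma mul_mem_of_mem_span {R : Type*} [CommRing R] {I : Ideal R} {f : R} {s : Set R}
    (h : ∀ g ∈ s, f * g ∈ I) : ∀ g ∈ Ideal.span s, f * g ∈ I :=
  Submodule.span_le (p := Submodule.comap (LinearMap.mulLeft R f) I).2 h

lemma esymm_cons_succ {R : Type*} [CommSemiring R] (x : R) (m : Multiset R) (j : ℕ) :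
    (x ::ₘ m).esymm (j + 1) = m.esymm (j + 1) + x * m.esymm j := by
  simp [Multiset.esymm, Multiset.powersetCard_cons, Multiset.sum_map_mul_left]

lemma esymm_eq_zero {R : Type*} [CommSemiring R] (m : Multiset R) {j : ℕ}
    (h : Multiset.card m < j) : m.esymm j = 0 := by
  simp [Multiset.esymm, Multiset.powersetCard_eq_empty _ h]

lemma sum_card_words_le {α : Type} [Fintype α] [DecidableEq α] (n : ℕ) (S : Finset α) :
    ∑ a : α, Nat.card {w : Fin n → α // ∀ b ∈ S.erase a, ∃ p, w p = b} ≤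
      Nat.card {w : Fin (n + 1) → α // ∀ b ∈ S, ∃ p, w p = b} := by
  rw [← Nat.card_sigma]
  refine Nat.card_le_card_of_injective (fun u => ⟨Fin.cons u.1 u.2.1, fun b hb => ?_⟩) ?_
  · by_cases hba : b = u.1
    · exact ⟨0, by simp [hba]⟩
    · obtain ⟨p, hp⟩ := u.2.2 b (Finset.mem_erase.2 ⟨hba, hb⟩)
      exact ⟨p.succ, by simpa using hp⟩
  · rintro ⟨a, w, hw⟩ ⟨a', w', hw'⟩ h
    have h' : (Fin.cons a w : Fin (n + 1) → α) = Fin.cons a' w' := Subtype.ext_iff.1 h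
    obtain ⟨rfl, rfl⟩ := Fin.cons_injective2 h'
    rfl

lemma adjoin_map_mk_eq_top {B : Type} [CommRing B] [Algebra ℚ B] {x : B} {m : Multiset B}
    (h : Algebra.adjoin ℚ {b | b ∈ x ::ₘ m} = ⊤) {C : Ideal B} (hx : x ∈ C) :
    Algebra.adjoin ℚ {b | b ∈ m.map (Ideal.Quotient.mk C)} = ⊤ := by
  rw [eq_top_iff, ← (AlgHom.range_eq_top (Ideal.Quotient.mkₐ ℚ C)).2
    (Ideal.Quotient.mkₐ_surjective ℚ C), ← Algebra.map_top, ← h, AlgHom.map_adjoin,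
    Algebra.adjoin_le_iff]
  rintro _ ⟨b, hb, rfl⟩
  rcases Multiset.mem_cons.1 hb with rfl | hb
  · have : Ideal.Quotient.mkₐ ℚ C b = 0 := Ideal.Quotient.eq_zero_iff_mem.2 hx
    rw [this]
    exact Subalgebra.zero_mem _
  · exact Algebra.subset_adjoin (Multiset.mem_map_of_mem _ hb)

lemma esymm_map_mk {B : Type} [CommRing B] (C : Ideal B) (m : Multiset B) (j : ℕ) :
    (m.map (Ideal.Quotient.mk C)).esymm j = Ideal.Quotient.mk C (m.esymm j) := by
  simp [Multiset.esymm, Multiset.powersetCard_map, Multiset.map_map,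
    map_multiset_sum, map_multiset_prod]

theorem rank_le_card_words {α : Type} [Fintype α] [DecidableEq α] (n : ℕ) :
    ∀ (S : Finset α) (B : Type) [CommRing B] [Algebra ℚ B] (m : Multiset B),
      Multiset.card m = n → Algebra.adjoin ℚ {b | b ∈ m} = ⊤ →
      (∀ b ∈ m, b ^ Fintype.card α = 0) → (∀ j, n < j + S.card → m.esymm j = 0) →
      Module.rank ℚ B ≤ (Nat.card {w : Fin n → α // ∀ a ∈ S, ∃ p, w p = a} : Cardinal) := by
  induction n with
  | zero =>
    intro S B _ _ m hm hgen _ hsymm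
    obtain rfl := Multiset.card_eq_zero.1 hm
    rcases S.eq_empty_or_nonempty with rfl | hS
    · have h1 : Nat.card {w : Fin 0 → α // ∀ a ∈ (∅ : Finset α), ∃ p, w p = a} = 1 := by
        simp
      have hsurj : Function.Surjective (Algebra.linearMap ℚ B) := by
        intro b
        have hb : b ∈ Algebra.adjoin ℚ {b | b ∈ (0 : Multiset B)} := hgen ▸ Algebra.mem_top
        simpa [Algebra.mem_bot] using hb
      rw [h1]
      simpa using LinearMap.rank_le_of_surjective _ hsurj
    · have h0 := hsymm 0 (by simpa using hS)
      have : Subsingleton B := subsingleton_of_zero_eq_one (by simpa [Multiset.esymm] using h0.symm)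
      simp
  | succ n ih =>
    intro S B _ _ m hm hgen hpow hsymm
    obtain ⟨x, m, rfl, hm⟩ := Multiset.card_eq_succ_iff.1 hm
    set k := Fintype.card α with hk
    set s := S.card with hs
    have hrec : ∀ j, n < j + s → x * m.esymm j = - m.esymm (j + 1) := by
      intro j hj
      have := hsymm (j + 1) (by omega)
      rw [esymm_cons_succ] at this
      linear_combination this
    have hkill : ∀ i j, n < j + s → n < j + i → x ^ i * m.esymm j = 0 := by
      intro i
      induction i with
      | zero => intro j _ hj; rw [esymm_eq_zero m (by omega), mul_zero]
      | succ i ihi =>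
        intro j hjs hj
        rw [pow_succ, mul_assoc, hrec j hjs, mul_neg, ihi (j + 1) (by omega) (by omega), neg_zero]
    let C₁ : Ideal B := Ideal.span {x}
    let C₂ : Ideal B := Ideal.span {x} ⊔ Ideal.span {g | ∃ j, n < j + s ∧ g = m.esymm j}
    have hx₁ : x ∈ C₁ := Ideal.mem_span_singleton_self x
    have hx₂ : x ∈ C₂ := Ideal.mem_sup_left hx₁
    have hquot : ∀ (C : Ideal B), x ∈ C → ∀ T : Finset α,
        (∀ j, n < j + T.card → m.esymm j ∈ C) → Module.rank ℚ (B ⧸ C) ≤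
          (Nat.card {w : Fin n → α // ∀ a ∈ T, ∃ p, w p = a} : Cardinal) := by
      intro C hxC T hT
      refine ih T (B ⧸ C) (m.map (Ideal.Quotient.mk C)) (by simpa using hm)
        (adjoin_map_mk_eq_top hgen hxC) ?_ ?_
      · intro b hb
        obtain ⟨c, hc, rfl⟩ := Multiset.mem_map.1 hb
        rw [← map_pow, hpow c (Multiset.mem_cons_of_mem hc), map_zero]
      · intro j hj
        rw [esymm_map_mk]
        exact Ideal.Quotient.eq_zero_iff_mem.2 (hT j hj)
    have hfilt : ∀ i, Module.rank ℚ (B ⧸ Ideal.span {x ^ i}) ≤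
        ∑ l ∈ Finset.range i,
          (if l < s then Module.rank ℚ (B ⧸ C₁) else Module.rank ℚ (B ⧸ C₂)) := by
      intro i
      induction i with
      | zero =>
        have : Subsingleton (B ⧸ Ideal.span {x ^ 0}) := by
          rw [Ideal.Quotient.subsingleton_iff]; simp
        simp
      | succ i ihi =>
        rw [Finset.sum_range_succ]
        have hsup : Ideal.span {x ^ (i + 1)} ⊔ Ideal.span {x ^ i} = Ideal.span {x ^ i} :=
          sup_eq_right.2 (Ideal.span_singleton_le_span_singleton.2 (pow_dvd_pow x i.le_succ))
        have hx : ∀ g ∈ Ideal.span {x}, x ^ i * g ∈ Ideal.span {x ^ (i + 1)} := by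
          intro g hg
          obtain ⟨b, rfl⟩ := Ideal.mem_span_singleton'.1 hg
          exact Ideal.mem_span_singleton'.2 ⟨b, by ring⟩
        split_ifs with his
        · have := rank_quotient_le_add_of_mul_mem (I := Ideal.span {x ^ (i + 1)}) (I' := C₁)
            (x ^ i) hx
          rw [hsup] at this
          exact this.trans (by gcongr)
        · have hmul : ∀ g ∈ C₂, x ^ i * g ∈ Ideal.span {x ^ (i + 1)} := by
            intro g hg
            obtain ⟨y, hy, z, hz, rfl⟩ := Submodule.mem_sup.1 hg
            rw [mul_add]
            refine Ideal.add_mem _ (hx y hy) ?_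
            refine mul_mem_of_mem_span ?_ z hz
            rintro _ ⟨j, hj, rfl⟩
            rw [hkill i j hj (by omega)]
            exact Ideal.zero_mem _
          have := rank_quotient_le_add_of_mul_mem (I := Ideal.span {x ^ (i + 1)}) (x ^ i) hmul
          rw [hsup] at this
          exact this.trans (by gcongr)
    have hsk : s ≤ k := Finset.card_le_univ S
    have hsum : ∑ l ∈ Finset.range k,
          (if l < s then Module.rank ℚ (B ⧸ C₁) else Module.rank ℚ (B ⧸ C₂)) =
        ∑ a : α, (if a ∈ S then Module.rank ℚ (B ⧸ C₁) else Module.rank ℚ (B ⧸ C₂)) := by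
      have e1 : (Finset.range k).filter (· < s) = Finset.range s := by
        ext l; simp; omega
      have e2 : ((Finset.range k).filter (¬ · < s)).card = k - s := by
        have : (Finset.range k).filter (¬ · < s) = Finset.Ico s k := by
          ext l; simp; omega
        rw [this, Nat.card_Ico]
      have e3 : (Finset.univ.filter (· ∉ S)).card = k - s := by
        rw [← Finset.compl_filter]; simp [Finset.card_compl, hk, hs]
      rw [Finset.sum_ite, Finset.sum_ite, Finset.sum_const, Finset.sum_const, Finset.sum_const,
        Finset.sum_const, e1, e2, e3]
      simp [hs]
    have hfin := hfilt k
    rw [hpow x (Multiset.mem_cons_self x m), hsum] at hfin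
    have hB : Module.rank ℚ B ≤ Module.rank ℚ (B ⧸ Ideal.span {(0 : B)}) := by
      refine LinearMap.rank_le_of_injective (Ideal.Quotient.mkₐ ℚ (Ideal.span {(0 : B)})).toLinearMap ?_
      intro a b hab
      simpa [sub_eq_zero] using Ideal.Quotient.eq.1 hab
    have hwords : ∑ a : α, (Nat.card {w : Fin n → α // ∀ b ∈ S.erase a, ∃ p, w p = b} :
        Cardinal.{0}) ≤ (Nat.card {w : Fin (n + 1) → α // ∀ b ∈ S, ∃ p, w p = b} : Cardinal) := by
      exact_mod_cast sum_card_words_le n S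
    refine (hB.trans hfin).trans ((Finset.sum_le_sum fun a _ => ?_).trans hwords)
    split_ifs with ha
    · refine hquot C₁ hx₁ (S.erase a) fun j hj => ?_
      rw [Finset.card_erase_of_mem ha, ← hs] at hj
      have hpos : 0 < s := Finset.card_pos.2 ⟨a, ha⟩
      rcases j with _ | j
      · have h0 := hsymm 0 (by omega)
        simp only [Multiset.esymm, Multiset.powersetCard_zero_left] at h0 ⊢
        rw [h0]
        exact Ideal.zero_mem _
      · rw [← neg_neg (m.esymm (j + 1)), ← hrec j (by omega)]
        exact neg_mem (Ideal.mul_mem_right _ _ hx₁)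
    · rw [Finset.erase_eq_of_notMem ha]
      exact hquot C₂ hx₂ S fun j hj =>
        Ideal.mem_sup_right (Ideal.subset_span ⟨j, hj, rfl⟩)

lemma homogeneousComponent_add_mul {σ : Type} {a : ℕ} {h : MvPolynomial σ ℚ}
    (hh : h.IsHomogeneous a) (b : ℕ) (f : MvPolynomial σ ℚ) :
    MvPolynomial.homogeneousComponent (a + b) (h * f) =
      h * MvPolynomial.homogeneousComponent b f := by
  induction f using MvPolynomial.induction_on' with
  | monomial d c =>
    rw [MvPolynomial.homogeneousComponent_of_mem
        (hh.mul (MvPolynomial.isHomogeneous_monomial c rfl)),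
      MvPolynomial.homogeneousComponent_of_mem (MvPolynomial.isHomogeneous_monomial c rfl)]
    simp
  | add p q hp hq => rw [mul_add, map_add, map_add, hp, hq, mul_add]

/-- The degree-`e` leading forms of the members of `I` of degree at most `e`. -/
noncomputable def leadingForms {σ : Type} (I : Ideal (MvPolynomial σ ℚ)) (e : ℕ) :
    Submodule ℚ (MvPolynomial σ ℚ) :=
  Submodule.map (MvPolynomial.homogeneousComponent e)
    (I.restrictScalars ℚ ⊓ ⨅ e' > e, LinearMap.ker (MvPolynomial.homogeneousComponent e'))

lemma mem_leadingForms {σ : Type} {I : Ideal (MvPolynomial σ ℚ)} {e : ℕ}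
    {g : MvPolynomial σ ℚ} :
    g ∈ leadingForms I e ↔ ∃ f ∈ I, (∀ e' > e, MvPolynomial.homogeneousComponent e' f = 0) ∧
      MvPolynomial.homogeneousComponent e f = g := by
  simp [leadingForms, and_assoc]

lemma isHomogeneous_of_mem_leadingForms {σ : Type} {I : Ideal (MvPolynomial σ ℚ)} {e : ℕ}
    {g : MvPolynomial σ ℚ} (hg : g ∈ leadingForms I e) : g.IsHomogeneous e := by
  obtain ⟨f, _, _, rfl⟩ := mem_leadingForms.1 hg
  exact MvPolynomial.homogeneousComponent_isHomogeneous e f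

lemma mul_mem_leadingForms {σ : Type} {I : Ideal (MvPolynomial σ ℚ)} {a b : ℕ}
    {h g : MvPolynomial σ ℚ} (hh : h.IsHomogeneous a) (hg : g ∈ leadingForms I b) :
    h * g ∈ leadingForms I (a + b) := by
  obtain ⟨f, hf, hf0, rfl⟩ := mem_leadingForms.1 hg
  refine mem_leadingForms.2 ⟨h * f, I.mul_mem_left h hf, fun e he => ?_,
    homogeneousComponent_add_mul hh b f⟩
  obtain ⟨c, rfl⟩ := Nat.exists_eq_add_of_lt he
  rw [show a + b + c + 1 = a + (b + c + 1) by ring, homogeneousComponent_add_mul hh,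
    hf0 _ (by omega), mul_zero]

lemma homogeneousComponent_mem_leadingForms {σ : Type} {I : Ideal (MvPolynomial σ ℚ)} {e : ℕ}
    {g : MvPolynomial σ ℚ} (hg : g ∈ leadingForms I e) (e' : ℕ) :
    MvPolynomial.homogeneousComponent e' g ∈ leadingForms I e' := by
  rw [MvPolynomial.homogeneousComponent_of_mem (isHomogeneous_of_mem_leadingForms hg)]
  split_ifs with h
  · exact h ▸ hg
  · exact Submodule.zero_mem _

/-- The ideal of leading forms (the associated graded ideal) of `I`. -/
noncomputable def leadingIdeal {σ : Type} (I : Ideal (MvPolynomial σ ℚ)) :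
    Ideal (MvPolynomial σ ℚ) where
  carrier := {p | ∀ e, MvPolynomial.homogeneousComponent e p ∈ leadingForms I e}
  zero_mem' e := by simp
  add_mem' hp hq e := by rw [map_add]; exact add_mem (hp e) (hq e)
  smul_mem' r p hp e := by
    rw [smul_eq_mul, ← MvPolynomial.sum_homogeneousComponent r,
      ← MvPolynomial.sum_homogeneousComponent p, Finset.sum_mul_sum]
    simp only [map_sum]
    exact Submodule.sum_mem _ fun a _ => Submodule.sum_mem _ fun b _ =>
      homogeneousComponent_mem_leadingForms (mul_mem_leadingForms
        (MvPolynomial.homogeneousComponent_isHomogeneous a r) (hp b)) e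

lemma mem_leadingIdeal_of_mem_leadingForms {σ : Type} {I : Ideal (MvPolynomial σ ℚ)} {e : ℕ}
    {g : MvPolynomial σ ℚ} (hg : g ∈ leadingForms I e) : g ∈ leadingIdeal I :=
  homogeneousComponent_mem_leadingForms hg

lemma rank_quotient_le_rank_quotient_leadingIdeal {σ : Type} (I : Ideal (MvPolynomial σ ℚ)) :
    Module.rank ℚ (MvPolynomial σ ℚ ⧸ I) ≤ Module.rank ℚ (MvPolynomial σ ℚ ⧸ leadingIdeal I) := by
  choose D hD using fun e => Submodule.exists_isCompl (leadingForms I e)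
  let E : Submodule ℚ (MvPolynomial σ ℚ) :=
    ⨅ e, (D e).comap (MvPolynomial.homogeneousComponent e)
  have hE : ∀ p, p ∈ E ↔ ∀ e, MvPolynomial.homogeneousComponent e p ∈ D e := by
    intro p; simp [E]
  have hspan : ∀ d (p : MvPolynomial σ ℚ),
      (∀ e ≥ d, MvPolynomial.homogeneousComponent e p = 0) → ∃ c ∈ E, p - c ∈ I := by
    intro d
    induction d with
    | zero =>
      intro p hp
      refine ⟨0, zero_mem E, ?_⟩
      rw [← MvPolynomial.sum_homogeneousComponent p,
        Finset.sum_eq_zero fun e _ => hp e e.zero_le, sub_zero]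
      exact I.zero_mem
    | succ d ih =>
      intro p hp
      obtain ⟨g, hg, c, hc, hgc⟩ := Submodule.mem_sup.1
        ((hD d).sup_eq_top ▸ Submodule.mem_top :
          MvPolynomial.homogeneousComponent d p ∈ leadingForms I d ⊔ D d)
      have hchom : c.IsHomogeneous d := by
        rw [← add_sub_cancel_left g c, hgc]
        exact (MvPolynomial.homogeneousComponent_isHomogeneous d p).sub
          (isHomogeneous_of_mem_leadingForms hg)
      have hcE : c ∈ E := by
        rw [hE]
        intro e
        rw [MvPolynomial.homogeneousComponent_of_mem hchom]
        split_ifs with h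
        · exact h ▸ hc
        · exact zero_mem _
      obtain ⟨f, hf, hf0, hfg⟩ := mem_leadingForms.1 hg
      obtain ⟨c', hc', hI⟩ := ih (p - c - f) fun e he => by
        rw [map_sub, map_sub, MvPolynomial.homogeneousComponent_of_mem hchom]
        rcases eq_or_lt_of_le he with rfl | he
        · rw [if_pos rfl, hfg, ← hgc]; ring
        · rw [if_neg (by omega), hf0 e he, hp e he]; ring
      refine ⟨c + c', add_mem hcE hc', ?_⟩
      convert add_mem hI hf using 1
      ring
  have hsurj : Function.Surjective ((Ideal.Quotient.mkₐ ℚ I).toLinearMap ∘ₗ E.subtype) := by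
    intro y
    obtain ⟨p, rfl⟩ := Ideal.Quotient.mk_surjective y
    obtain ⟨c, hc, hpc⟩ := hspan (p.totalDegree + 1) p fun e he =>
      MvPolynomial.homogeneousComponent_eq_zero e p he
    exact ⟨⟨c, hc⟩, (Ideal.Quotient.eq.2 hpc).symm⟩
  have hinj : Function.Injective
      ((Ideal.Quotient.mkₐ ℚ (leadingIdeal I)).toLinearMap ∘ₗ E.subtype) := by
    rw [← LinearMap.ker_eq_bot, LinearMap.ker_eq_bot']
    rintro ⟨p, hp⟩ h
    have hpL : p ∈ leadingIdeal I := Ideal.Quotient.eq_zero_iff_mem.1 h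
    refine Subtype.ext ?_
    change p = 0
    rw [← MvPolynomial.sum_homogeneousComponent p]
    exact Finset.sum_eq_zero fun e _ =>
      Submodule.disjoint_def.1 (hD e).disjoint _ (hpL e) ((hE p).1 hp e)
  exact (LinearMap.rank_le_of_surjective _ hsurj).trans (LinearMap.rank_le_of_injective _ hinj)

/-- The ideal of polynomials vanishing at every point of a family. -/
noncomputable def pointIdeal {σ W : Type} (x : W → σ → ℚ) : Ideal (MvPolynomial σ ℚ) :=
  ⨅ w, RingHom.ker (MvPolynomial.eval (x w))

lemma mem_pointIdeal {σ W : Type} {x : W → σ → ℚ} {f : MvPolynomial σ ℚ} :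
    f ∈ pointIdeal x ↔ ∀ w, MvPolynomial.eval (x w) f = 0 := by
  simp [pointIdeal, RingHom.mem_ker]

lemma eval_family_surjective {σ W : Type} [Finite W] {x : W → σ → ℚ}
    (hx : Function.Injective x) :
    Function.Surjective fun (f : MvPolynomial σ ℚ) w => MvPolynomial.eval (x w) f := by
  classical
  have := Fintype.ofFinite W
  have hsep : ∀ w w', ∃ g : MvPolynomial σ ℚ, MvPolynomial.eval (x w') g = 0 ∧
      (w ≠ w' → MvPolynomial.eval (x w) g ≠ 0) := by
    intro w w'
    by_cases h : w = w'
    · exact ⟨0, map_zero _, fun h' => absurd h h'⟩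
    · obtain ⟨p, hp⟩ := Function.ne_iff.1 (hx.ne h)
      exact ⟨MvPolynomial.X p - MvPolynomial.C (x w' p), by simp,
        fun _ => by simpa [sub_ne_zero] using hp⟩
  choose g hg0 hg using hsep
  let L : W → MvPolynomial σ ℚ := fun w => ∏ w' ∈ Finset.univ.erase w, g w w'
  have hL : ∀ w, MvPolynomial.eval (x w) (L w) ≠ 0 := by
    intro w
    rw [map_prod]
    exact Finset.prod_ne_zero_iff.2 fun w' hw' => hg w w' (Finset.ne_of_mem_erase hw').symm
  have hL0 : ∀ w w', w' ≠ w → MvPolynomial.eval (x w') (L w) = 0 := by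
    intro w w' h
    rw [map_prod]
    exact Finset.prod_eq_zero (Finset.mem_erase.2 ⟨h, Finset.mem_univ w'⟩) (hg0 w w')
  intro v
  refine ⟨∑ w, MvPolynomial.C (v w / MvPolynomial.eval (x w) (L w)) * L w, funext fun w => ?_⟩
  simp only [map_sum, map_mul, MvPolynomial.eval_C]
  rw [Finset.sum_eq_single w (fun w' _ h => by rw [hL0 w' w h.symm, mul_zero]) (by simp),
    div_mul_cancel₀ _ (hL w)]

lemma card_le_rank_quotient_pointIdeal {σ W : Type} [Finite W] {x : W → σ → ℚ}
    (hx : Function.Injective x) :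
    (Nat.card W : Cardinal) ≤ Module.rank ℚ (MvPolynomial σ ℚ ⧸ pointIdeal x) := by
  have := Fintype.ofFinite W
  let ev : MvPolynomial σ ℚ →ₐ[ℚ] (W → ℚ) := AlgHom.pi fun w => MvPolynomial.aeval (x w)
  let φ : (MvPolynomial σ ℚ ⧸ pointIdeal x) →ₐ[ℚ] (W → ℚ) :=
    Ideal.Quotient.liftₐ (pointIdeal x) ev fun f hf => funext fun w => by
      simpa [ev, MvPolynomial.aeval_eq_eval] using mem_pointIdeal.1 hf w
  have hφ : Function.Surjective φ.toLinearMap := by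
    intro v
    obtain ⟨f, hf⟩ := eval_family_surjective hx v
    refine ⟨Ideal.Quotient.mk _ f, ?_⟩
    rw [← hf]
    funext w
    change MvPolynomial.aeval (x w) f = _
    rw [MvPolynomial.aeval_eq_eval]
  simpa [Nat.card_eq_fintype_card] using LinearMap.rank_le_of_surjective _ hφ

/-- `f` has degree at most `e`, with degree-`e` component `g`. -/
def HasLeadingForm {σ : Type} (f : MvPolynomial σ ℚ) (e : ℕ) (g : MvPolynomial σ ℚ) : Prop :=
  (∀ e' > e, MvPolynomial.homogeneousComponent e' f = 0) ∧
    MvPolynomial.homogeneousComponent e f = g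

lemma HasLeadingForm.mem_leadingIdeal {σ : Type} {f g : MvPolynomial σ ℚ} {e : ℕ}
    (h : HasLeadingForm f e g) {I : Ideal (MvPolynomial σ ℚ)} (hf : f ∈ I) :
    g ∈ leadingIdeal I :=
  mem_leadingIdeal_of_mem_leadingForms (mem_leadingForms.2 ⟨f, hf, h.1, h.2⟩)

lemma HasLeadingForm.X_sub_C_mul {σ : Type} {f g : MvPolynomial σ ℚ} {e : ℕ}
    (h : HasLeadingForm f e g) (i : σ) (c : ℚ) :
    HasLeadingForm ((MvPolynomial.X i - MvPolynomial.C c) * f) (e + 1)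
      (MvPolynomial.X i * g) := by
  have hcomp : ∀ b, MvPolynomial.homogeneousComponent (b + 1)
      ((MvPolynomial.X i - MvPolynomial.C c) * f) =
      MvPolynomial.X i * MvPolynomial.homogeneousComponent b f -
        MvPolynomial.C c * MvPolynomial.homogeneousComponent (b + 1) f := by
    intro b
    rw [sub_mul, map_sub, add_comm b 1, homogeneousComponent_add_mul
      (MvPolynomial.isHomogeneous_X ℚ i), MvPolynomial.homogeneousComponent_C_mul]
  refine ⟨fun e' he' => ?_, ?_⟩
  · obtain ⟨b, rfl⟩ := Nat.exists_eq_add_of_lt he'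
    rw [hcomp, h.1 _ (by omega), h.1 _ (by omega), mul_zero, mul_zero, sub_zero]
  · rw [hcomp, h.2, h.1 _ (by omega), mul_zero, sub_zero]

lemma HasLeadingForm.prod_X_sub_C_mul {σ : Type} {f g : MvPolynomial σ ℚ} {e : ℕ}
    (h : HasLeadingForm f e g) (i : σ) (c : ℕ → ℚ) (r : ℕ) :
    HasLeadingForm ((∏ l ∈ Finset.range r, (MvPolynomial.X i - MvPolynomial.C (c l))) * f)
      (e + r) (MvPolynomial.X i ^ r * g) := by
  induction r with
  | zero => simpa using h
  | succ r ih =>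
    rw [Finset.prod_range_succ, mul_comm (Finset.prod _ _), mul_assoc, pow_succ', mul_assoc]
    exact ih.X_sub_C_mul i (c r)

lemma coeff_prod_one_add_C_mul_X {ι : Type} (s : Finset ι) (y : ι → ℚ) (a : ℕ) :
    PowerSeries.coeff a (∏ i ∈ s, (1 + PowerSeries.C (y i) * PowerSeries.X)) =
      ∑ t ∈ s.powersetCard a, ∏ i ∈ t, y i := by
  rw [Finset.prod_one_add, map_sum, Finset.powersetCard_eq_filter, Finset.sum_filter]
  refine Finset.sum_congr rfl fun t _ => ?_
  rw [Finset.prod_mul_distrib, Finset.prod_const, ← map_prod, PowerSeries.coeff_C_mul,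
    PowerSeries.coeff_X_pow]
  simp [eq_comm]

/-- The power series `∏_{l = 1}^{r} (1 + l t)`. -/
noncomputable def letterSeries (r : ℕ) : PowerSeries ℚ :=
  ∏ l ∈ Finset.range r, (1 + PowerSeries.C ((l : ℚ) + 1) * PowerSeries.X)

lemma constantCoeff_letterSeries (r : ℕ) : PowerSeries.constantCoeff (letterSeries r) = 1 := by
  simp [letterSeries, map_prod]

/-- The degree-`j` coefficient of `∏_{i ∈ s} (1 + x_i t) / ∏_{l = 1}^{r} (1 + l t)`. -/
noncomputable def esymmQuot (n : ℕ) (s : Finset (Fin n)) (r j : ℕ) : MvPolynomial (Fin n) ℚ :=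
  ∑ p ∈ Finset.HasAntidiagonal.antidiagonal j,
    MvPolynomial.C (PowerSeries.coeff p.2 (letterSeries r)⁻¹) * esymmOn n s p.1

lemma eval_esymmQuot_eq_zero {n : ℕ} {s : Finset (Fin n)} {r j : ℕ} {y : Fin n → ℚ}
    (hy : ∀ l < r, ∃ p ∈ s, y p = (l : ℚ) + 1) (hj : s.card < j + r) :
    MvPolynomial.eval y (esymmQuot n s r j) = 0 := by
  choose q hqs hq using fun l : Fin r => hy l l.2
  have hinj : Function.Injective q := by
    intro a b hab
    have h := (hq a).symm.trans ((congrArg y hab).trans (hq b))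
    exact Fin.ext (by exact_mod_cast add_right_cancel h)
  have hsub : Finset.univ.image q ⊆ s := by
    intro p hp
    obtain ⟨l, -, rfl⟩ := Finset.mem_image.1 hp
    exact hqs l
  have hcard : (Finset.univ.image q).card = r := by
    rw [Finset.card_image_of_injective _ hinj, Finset.card_univ, Fintype.card_fin]
  have hletters : ∏ i ∈ Finset.univ.image q, (1 + PowerSeries.C (y i) * PowerSeries.X) =
      letterSeries r := by
    rw [Finset.prod_image hinj.injOn, letterSeries, Finset.prod_range]
    exact Finset.prod_congr rfl fun l _ => by rw [hq l]
  have hcoeff : MvPolynomial.eval y (esymmQuot n s r j) =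
      PowerSeries.coeff j ((∏ i ∈ s, (1 + PowerSeries.C (y i) * PowerSeries.X)) *
        (letterSeries r)⁻¹) := by
    rw [PowerSeries.coeff_mul, esymmQuot, map_sum]
    refine Finset.sum_congr rfl fun p _ => ?_
    rw [coeff_prod_one_add_C_mul_X, mul_comm, map_mul, MvPolynomial.eval_C, esymmOn, map_sum]
    simp [map_prod]
  rw [hcoeff, ← Finset.prod_sdiff hsub, hletters, mul_assoc, PowerSeries.mul_inv_cancel _
    (by rw [constantCoeff_letterSeries]; exact one_ne_zero), mul_one, coeff_prod_one_add_C_mul_X,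
    Finset.powersetCard_eq_empty.2, Finset.sum_empty]
  have := Finset.card_le_card hsub
  rw [Finset.card_sdiff_of_subset hsub]
  omega

lemma esymmOn_isHomogeneous (n : ℕ) (s : Finset (Fin n)) (a : ℕ) :
    (esymmOn n s a).IsHomogeneous a := by
  refine MvPolynomial.IsHomogeneous.sum _ _ _ fun t ht => ?_
  convert MvPolynomial.IsHomogeneous.prod t _ (fun _ => 1)
    fun i _ => MvPolynomial.isHomogeneous_X ℚ i
  simp [(Finset.mem_powersetCard.1 ht).2]

lemma hasLeadingForm_esymmQuot (n : ℕ) (s : Finset (Fin n)) (r j : ℕ) :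
    HasLeadingForm (esymmQuot n s r j) j (esymmOn n s j) := by
  have hcomp : ∀ e, MvPolynomial.homogeneousComponent e (esymmQuot n s r j) =
      ∑ p ∈ Finset.HasAntidiagonal.antidiagonal j, MvPolynomial.C (PowerSeries.coeff p.2 (letterSeries r)⁻¹) *
        if e = p.1 then esymmOn n s p.1 else 0 := by
    intro e
    rw [esymmQuot, map_sum]
    refine Finset.sum_congr rfl fun p _ => ?_
    rw [MvPolynomial.homogeneousComponent_C_mul,
      MvPolynomial.homogeneousComponent_of_mem (esymmOn_isHomogeneous n s p.1)]
  refine ⟨fun e he => ?_, ?_⟩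
  · rw [hcomp]
    refine Finset.sum_eq_zero fun p hp => ?_
    have := Finset.HasAntidiagonal.mem_antidiagonal.1 hp
    rw [if_neg (by omega), mul_zero]
  · rw [hcomp, Finset.sum_eq_single (j, 0)]
    · simp [constantCoeff_letterSeries]
    · intro p hp hne
      have := Finset.HasAntidiagonal.mem_antidiagonal.1 hp
      rw [if_neg, mul_zero]
      rintro rfl
      exact hne (Prod.ext rfl (by simp; omega))
    · simp

lemma Packedk.exists_eq_of_le {n k : ℕ} {w : Fin n → ℕ} (h : Packedk n k w) {l m : ℕ}
    (hl : 1 ≤ l) (hlm : l ≤ m) (hm : ∃ p, w p = m) : ∃ p, w p = l := by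
  induction m, hlm using Nat.le_induction with
  | base => exact hm
  | succ m hlm ih => exact ih (h.2.1 m (hl.trans hlm) hm)

lemma Packedk.le_length {n k : ℕ} {w : Fin n → ℕ} (h : Packedk n k w) (p : Fin n) : w p ≤ n := by
  have hex : ∀ l : Fin (w p), ∃ q, w q = l + 1 := fun l =>
    h.exists_eq_of_le (by omega) l.2 ⟨p, rfl⟩
  choose q hq using hex
  have hinj : Function.Injective q := fun a b hab => by
    have := (hq a).symm.trans ((congrArg w hab).trans (hq b))
    exact Fin.ext (by omega)
  simpa using Fintype.card_le_of_injective q hinj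

instance packedk_finite (n k : ℕ) : Finite {w : Fin n → ℕ // Packedk n k w} := by
  refine Finite.of_injective (β := Fin n → Fin (n + 1))
    (fun w p => ⟨w.1 p, Nat.lt_succ_of_le (w.2.le_length p)⟩) fun w w' h => ?_
  exact Subtype.ext (funext fun p => congrArg Fin.val (congrFun h p))

lemma Jnk_le_leadingIdeal {n k : ℕ} :
    Jnk n k ≤ leadingIdeal (pointIdeal
      fun (w : {w : Fin n → ℕ // Packedk n k w}) p => (w.1 p : ℚ)) := by
  refine sup_le (Ideal.span_le.2 ?_) (Ideal.span_le.2 ?_)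
  · rintro _ ⟨i, r, d, hr, hrd, rfl⟩
    obtain ⟨d, rfl⟩ := Nat.exists_eq_add_of_le' hrd
    rw [pow_add, mul_assoc]
    refine Ideal.mul_mem_left _ _ (((hasLeadingForm_esymmQuot n {i}ᶜ r (n - r)).prod_X_sub_C_mul
      i (fun l => (l : ℚ) + 1) r).mem_leadingIdeal (mem_pointIdeal.2 fun w => ?_))
    rw [map_mul, map_prod]
    have hpos := w.2.1 i
    rcases le_or_gt (w.1 i) r with hle | hlt
    · rw [Finset.prod_eq_zero (Finset.mem_range.2 (show w.1 i - 1 < r by omega)), zero_mul]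
      simp [Nat.cast_sub hpos]
    · rw [eval_esymmQuot_eq_zero ?_ ?_, mul_zero]
      · intro l hl
        obtain ⟨q, hq⟩ := w.2.exists_eq_of_le (l := l + 1) (by omega) (by omega) ⟨i, rfl⟩
        refine ⟨q, ?_, by simp [hq]⟩
        rw [Finset.mem_compl, Finset.mem_singleton]
        rintro rfl
        omega
      · have := i.pos
        rw [Finset.card_compl, Fintype.card_fin, Finset.card_singleton]
        omega
  · rintro _ ⟨j, hj, -, rfl⟩
    refine (hasLeadingForm_esymmQuot n Finset.univ k j).mem_leadingIdeal
      (mem_pointIdeal.2 fun w => eval_esymmQuot_eq_zero (fun l hl => ?_) ?_)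
    · obtain ⟨q, hq⟩ := w.2.2.2 (l + 1) (by omega) hl
      exact ⟨q, Finset.mem_univ q, by simp [hq]⟩
    · rw [Finset.card_univ, Fintype.card_fin]
      omega

lemma card_packedk_le_rank (n k : ℕ) :
    (Nat.card {w : Fin n → ℕ // Packedk n k w} : Cardinal) ≤
      Module.rank ℚ (MvPolynomial (Fin n) ℚ ⧸ Jnk n k) := by
  refine (card_le_rank_quotient_pointIdeal
    (x := fun (w : {w : Fin n → ℕ // Packedk n k w}) p => (w.1 p : ℚ)) ?_).trans
    ((rank_quotient_le_rank_quotient_leadingIdeal _).trans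
      (rank_quotient_mono Jnk_le_leadingIdeal))
  intro w w' h
  exact Subtype.ext (funext fun p => Nat.cast_injective (R := ℚ) (congrFun h p))

lemma esymmOn_eq_esymm (n : ℕ) (s : Finset (Fin n)) (a : ℕ) :
    esymmOn n s a = (s.val.map (MvPolynomial.X (R := ℚ))).esymm a :=
  (Finset.esymm_map_val _ s a).symm

lemma esymmOn_univ_succ (n : ℕ) (i : Fin n) (a : ℕ) :
    esymmOn n Finset.univ (a + 1) =
      esymmOn n {i}ᶜ (a + 1) + MvPolynomial.X i * esymmOn n {i}ᶜ a := by
  have hi : i ∉ ({i}ᶜ : Finset (Fin n)) := by simp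
  have hval : (Finset.univ : Finset (Fin n)).val = i ::ₘ ({i}ᶜ : Finset (Fin n)).val := by
    rw [← Finset.insert_compl_self i, Finset.insert_val_of_notMem hi]
  rw [esymmOn_eq_esymm, esymmOn_eq_esymm, esymmOn_eq_esymm, hval, Multiset.map_cons,
    esymm_cons_succ]

lemma rank_quotient_Ink_le {n k : ℕ} (hkn : k ≤ n) :
    Module.rank ℚ (MvPolynomial (Fin n) ℚ ⧸ Ink n k) ≤
      (Nat.card {w : Fin n → Fin k // ∀ a ∈ Finset.univ, ∃ p, w p = a} : Cardinal) := by
  refine rank_le_card_words n Finset.univ _ ((Finset.univ.val.map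
    (MvPolynomial.X (R := ℚ))).map (Ideal.Quotient.mk (Ink n k))) (by simp) ?_ ?_ ?_
  · have hset : {b | b ∈ (Finset.univ.val.map (MvPolynomial.X (R := ℚ))).map
        (Ideal.Quotient.mk (Ink n k))} = Ideal.Quotient.mkₐ ℚ (Ink n k) ''
          Set.range (MvPolynomial.X : Fin n → MvPolynomial (Fin n) ℚ) := by
      ext b
      simp
    rw [hset, ← AlgHom.map_adjoin, MvPolynomial.adjoin_range_X, Algebra.map_top]
    exact (AlgHom.range_eq_top _).2 (Ideal.Quotient.mkₐ_surjective ℚ _)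
  · intro b hb
    simp only [Multiset.mem_map] at hb
    obtain ⟨_, ⟨i, -, rfl⟩, rfl⟩ := hb
    rw [Fintype.card_fin, ← map_pow]
    exact Ideal.Quotient.eq_zero_iff_mem.2 (Ideal.subset_span (Or.inl ⟨i, rfl⟩))
  · intro j hj
    rw [Finset.card_univ, Fintype.card_fin] at hj
    rcases le_or_gt j n with hjn | hjn
    · rw [esymm_map_mk, ← esymmOn_eq_esymm]
      exact Ideal.Quotient.eq_zero_iff_mem.2
        (Ideal.subset_span (Or.inr ⟨j, by omega, hjn, rfl⟩))
    · exact esymm_eq_zero _ (by simpa using hjn)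

lemma X_pow_mul_esymmOn_mem_Jn {n : ℕ} (i : Fin n) {r : ℕ} (hr : 1 ≤ r) :
    MvPolynomial.X i ^ r * esymmOn n {i}ᶜ (n - r) ∈ Jn n :=
  Ideal.subset_span ⟨i, r, r, hr, le_rfl, rfl⟩

lemma esymmOn_mem_Jnk {n k j : ℕ} (hj : n - k + 1 ≤ j) (hjn : j ≤ n) :
    esymmOn n Finset.univ j ∈ Jnk n k :=
  Ideal.mem_sup_right (Ideal.subset_span ⟨j, hj, hjn, rfl⟩)

lemma Ink_le_Jnk_self {n : ℕ} (hn : 1 ≤ n) : Ink n n ≤ Jnk n n := by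
  refine Ideal.span_le.2 ?_
  rintro _ (⟨i, rfl⟩ | ⟨j, hj, hjn, rfl⟩)
  · have h := X_pow_mul_esymmOn_mem_Jn i hn
    rw [Nat.sub_self, esymmOn, Finset.powersetCard_zero, Finset.sum_singleton, Finset.prod_empty,
      mul_one] at h
    exact Ideal.mem_sup_left h
  · exact esymmOn_mem_Jnk hj hjn

lemma Jnk_succ_le {n k : ℕ} :
    Jnk n (k + 1) ≤ Jnk n k ⊔ Ideal.span {esymmOn n Finset.univ (n - k)} := by
  refine sup_le (le_sup_left.trans le_sup_left) (Ideal.span_le.2 ?_)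
  rintro _ ⟨j, hj, hjn, rfl⟩
  rcases eq_or_ne j (n - k) with rfl | hne
  · exact Ideal.mem_sup_right (Ideal.mem_span_singleton_self _)
  · exact Ideal.mem_sup_left (esymmOn_mem_Jnk (by omega) hjn)

lemma esymmOn_mul_mem_Jnk {n k : ℕ} (hk : 1 ≤ k) (hkn : k < n) :
    ∀ g ∈ Ink n k, esymmOn n Finset.univ (n - k) * g ∈ Jnk n k := by
  refine mul_mem_of_mem_span ?_
  rintro _ (⟨i, rfl⟩ | ⟨j, hj, hjn, rfl⟩)
  · refine Ideal.mem_sup_left ?_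
    rw [show n - k = n - (k + 1) + 1 by omega, esymmOn_univ_succ n i,
      show n - (k + 1) + 1 = n - k by omega]
    convert add_mem (X_pow_mul_esymmOn_mem_Jn i hk)
      (X_pow_mul_esymmOn_mem_Jn i (Nat.le_add_left 1 k)) using 1
    ring
  · exact Ideal.mul_mem_left _ _ (esymmOn_mem_Jnk hj hjn)

lemma packedk_of_surjective {n k : ℕ} {w : Fin n → Fin k}
    (hw : ∀ a ∈ Finset.univ, ∃ p, w p = a) : Packedk n k fun p => (w p : ℕ) + 1 := by
  have hall : ∀ j, 1 ≤ j → j ≤ k → ∃ p, (w p : ℕ) + 1 = j := by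
    intro j hj hjk
    obtain ⟨p, hp⟩ := hw ⟨j - 1, by omega⟩ (Finset.mem_univ _)
    exact ⟨p, by rw [hp]; exact Nat.sub_add_cancel hj⟩
  refine ⟨fun p => Nat.le_add_left 1 _, fun i hi ⟨p, hp⟩ => hall i hi ?_, hall⟩
  have := (w p).2
  simp only at hp
  omega

lemma shift_injective {n k : ℕ} {w w' : Fin n → Fin k}
    (h : (fun p => (w p : ℕ) + 1) = fun p => (w' p : ℕ) + 1) : w = w' :=
  funext fun p => Fin.ext (Nat.succ_injective (congrFun h p))

lemma card_surjective_le_card_packedk (n k : ℕ) :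
    Nat.card {w : Fin n → Fin k // ∀ a ∈ Finset.univ, ∃ p, w p = a} ≤
      Nat.card {w : Fin n → ℕ // Packedk n k w} :=
  Nat.card_le_card_of_injective (fun w => ⟨_, packedk_of_surjective w.2⟩) fun _ _ h =>
    Subtype.ext (shift_injective (Subtype.ext_iff.1 h))

lemma card_packedk_succ_add_le (n k : ℕ) :
    Nat.card {w : Fin n → ℕ // Packedk n (k + 1) w} +
      Nat.card {w : Fin n → Fin k // ∀ a ∈ Finset.univ, ∃ p, w p = a} ≤
      Nat.card {w : Fin n → ℕ // Packedk n k w} := by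
  rw [← Nat.card_sum]
  refine Nat.card_le_card_of_injective (Sum.elim
    (fun w => ⟨w.1, w.2.1, w.2.2.1, fun j hj hjk => w.2.2.2 j hj (by omega)⟩)
    fun w => ⟨_, packedk_of_surjective w.2⟩) (Function.Injective.sumElim ?_ ?_ ?_)
  · exact fun w w' h => Subtype.ext (congrArg (fun u => u.1) h)
  · exact fun _ _ h => Subtype.ext (shift_injective (Subtype.ext_iff.1 h))
  · intro w w' h
    obtain ⟨p, hp⟩ := w.2.2.2 (k + 1) (by omega) le_rfl
    have h' : w.1 p = w'.1 p + 1 := congrFun (Subtype.ext_iff.1 h) p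
    have := (w'.1 p).2
    omega

lemma rank_le_card_packedk {n k : ℕ} (hk : 1 ≤ k) (hkn : k ≤ n) :
    Module.rank ℚ (MvPolynomial (Fin n) ℚ ⧸ Jnk n k) ≤
      (Nat.card {w : Fin n → ℕ // Packedk n k w} : Cardinal) := by
  induction hkn using Nat.decreasingInduction with
  | self =>
    refine (rank_quotient_mono (Ink_le_Jnk_self hk)).trans ((rank_quotient_Ink_le le_rfl).trans ?_)
    exact_mod_cast card_surjective_le_card_packedk n n
  | of_succ k hkn ih =>
    refine (rank_quotient_le_add_of_mul_mem _ (esymmOn_mul_mem_Jnk hk hkn)).trans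
      ((add_le_add ((rank_quotient_mono Jnk_succ_le).trans (ih (by omega)))
        (rank_quotient_Ink_le hkn.le)).trans ?_)
    exact_mod_cast card_packedk_succ_add_le n k

/-- for `1 ≤ k ≤ n` the ring `S_{n,k} = ℚ[x_1, …, x_n]/J_{n,k}` is a
finite-dimensional `ℚ`-vector space of dimension `|W_{n,k}|`. -/
theorem Snk_dim (n k : ℕ) (hk : 1 ≤ k) (hkn : k ≤ n) :
    FiniteDimensional ℚ (MvPolynomial (Fin n) ℚ ⧸ Jnk n k) ∧
    Module.finrank ℚ (MvPolynomial (Fin n) ℚ ⧸ Jnk n k) =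
      Nat.card {w : Fin n → ℕ // Packedk n k w} := by
  have hrank := (rank_le_card_packedk hk hkn).antisymm (card_packedk_le_rank n k)
  exact ⟨Module.rank_lt_aleph0_iff.1 (hrank ▸ Cardinal.natCast_lt_aleph0),
    Module.finrank_eq_of_rank_eq hrank⟩

end PackedWords
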